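/- Let G be a transitive digraph and f a discrete Morse function on G. Then for every n ≥ 0, the space of Φ-invariant chains equals the span of the chains α + V∂(α) over critical paths: P_n^Φ(G) = span_ℝ{ α + V∂(α) : α a critical allowed elementary n-path on G }, where V = grad f and Φ = Id + ∂V + V∂. -/

import Mathlib

open scoped BigOperators Classical

namespace PathMorse

/-- A digraph: an irreflexive edge relation on a vertex set. -/
structure Digraph (V : Type) where
  E : V → V → Prop
  irrefl : ∀ v, ¬ E v v

/-- A digraph is transitive if `u→v` and `v→w` imply `u→w`. -/
def Digraph.Transitive {V : Type} (G : Digraph V) : Prop :=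
  ∀ u v w, G.E u v → G.E v w → G.E u w

/-- `Gbar` is the transitive closure of `G`: the smallest transitive digraph containing `G`. -/
def IsTransClosure {V : Type} (G Gbar : Digraph V) : Prop :=
  Gbar.Transitive ∧ (∀ u v, G.E u v → Gbar.E u v) ∧
    ∀ H : Digraph V, H.Transitive → (∀ u v, G.E u v → H.E u v) →
      ∀ u v, Gbar.E u v → H.E u v

/-- An elementary `n`-path on `V`: a sequence of `n+1` vertices. -/
abbrev Path (V : Type) (n : ℕ) := Fin (n+1) → V

/-- An elementary path is allowed on `G` if consecutive vertices are joined by directed edges. -/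
def Allowed {V : Type} (G : Digraph V) {n : ℕ} (p : Path V n) : Prop :=
  ∀ i : Fin n, G.E (p i.castSucc) (p i.succ)

/-- The `i`-th face of a path: delete the `i`-th vertex. -/
def face {V : Type} {n : ℕ} (i : Fin (n+2)) (p : Path V (n+1)) : Path V n :=
  p ∘ i.succAbove

/-- `q` is obtained from `p` by deleting one vertex (the codimension-one relation `q < p`). -/
def IsFace {V : Type} {n : ℕ} (q : Path V n) (p : Path V (n+1)) : Prop :=
  ∃ i : Fin (n+2), face i p = q

/-- Value of `f` on a path: sum of the values at the vertices. -/
def fPath {V : Type} (f : V → ℝ) {n : ℕ} (p : Path V n) : ℝ :=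
  ∑ i, f (p i)

/-- There is an allowed coface `γ > p` with `f γ = f p`. -/
def HasEqualCoface {V : Type} (G : Digraph V) (f : V → ℝ) {n : ℕ} (p : Path V n) : Prop :=
  ∃ γ : Path V (n+1), Allowed G γ ∧ IsFace p γ ∧ fPath f γ = fPath f p

/-- There is an allowed face `β < p` with `f β = f p`. -/
def HasEqualFace {V : Type} (G : Digraph V) (f : V → ℝ) : (n : ℕ) → Path V n → Prop
  | 0, _ => False
  | (n+1), p => ∃ β : Path V n, Allowed G β ∧ IsFace β p ∧ fPath f β = fPath f p

/-- A discrete Morse function on a digraph: nonnegative, and for each allowed elementary path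
there is at most one allowed coface with the same value, and at most one allowed face with the
same value. -/
def IsMorse {V : Type} (G : Digraph V) (f : V → ℝ) : Prop :=
  (∀ v, 0 ≤ f v) ∧
  (∀ n (α : Path V n), Allowed G α →
    ∀ γ₁ γ₂ : Path V (n+1), Allowed G γ₁ → Allowed G γ₂ → IsFace α γ₁ → IsFace α γ₂ →
      fPath f γ₁ = fPath f α → fPath f γ₂ = fPath f α → γ₁ = γ₂) ∧
  (∀ n (α : Path V (n+1)), Allowed G α →
    ∀ β₁ β₂ : Path V n, Allowed G β₁ → Allowed G β₂ → IsFace β₁ α → IsFace β₂ α →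
      fPath f β₁ = fPath f α → fPath f β₂ = fPath f α → β₁ = β₂)

/-- A critical path: allowed, with no allowed coface of equal value, no allowed face of equal value. -/
def IsCritical {V : Type} (G : Digraph V) (f : V → ℝ) {n : ℕ} (p : Path V n) : Prop :=
  Allowed G p ∧ ¬ HasEqualCoface G f p ∧ ¬ HasEqualFace G f n p

/-- `n`-chains: the real vector space with (orthonormal) basis the elementary `n`-paths. -/
abbrev Chain (V : Type) (n : ℕ) := Path V n → ℝ

variable {V : Type} [Fintype V] [DecidableEq V]

/-- The basis chain corresponding to an elementary path. -/
def unitP {n : ℕ} (p : Path V n) : Chain V n := Pi.single p 1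

/-- The boundary operator on chains (as a bare function). -/
def boundaryFun {n : ℕ} (x : Chain V (n+1)) : Chain V n :=
  fun q => ∑ p : Path V (n+1), x p * ∑ i : Fin (n+2), ((-1:ℝ)^(i:ℕ)) * (if face i p = q then 1 else 0)

/-- The boundary operator `∂ = Σ (-1)^i d_i` as a linear map. -/
def boundary (V : Type) [Fintype V] [DecidableEq V] (n : ℕ) : Chain V (n+1) →ₗ[ℝ] Chain V n where
  toFun := boundaryFun
  map_add' x y := by
    funext q
    simp [boundaryFun, add_mul, Finset.sum_add_distrib]
  map_smul' c x := by
    funext q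
    simp [boundaryFun, Finset.mul_sum, mul_assoc]

/-- `P_n(G)`: the span of the allowed elementary `n`-paths. -/
def pSpan (G : Digraph V) (n : ℕ) : Submodule ℝ (Chain V n) :=
  Submodule.span ℝ {x : Chain V n | ∃ p : Path V n, Allowed G p ∧ x = unitP p}

/-- `Ω_n(G) = {x ∈ P_n(G) : ∂x ∈ P_{n-1}(G)}` (with `Ω_0 = P_0`). -/
def omega (G : Digraph V) : (n : ℕ) → Submodule ℝ (Chain V n)
  | 0 => pSpan G 0
  | (n+1) => pSpan G (n+1) ⊓ (pSpan G n).comap (boundary V n)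

/-- The discrete gradient vector field on a basis path: `V(α) = -⟨∂γ,α⟩ γ` if there is an
allowed coface `γ > α` with `f γ = f α`, and `0` otherwise. -/
noncomputable def gradFun (G : Digraph V) (f : V → ℝ) {n : ℕ} (α : Path V n) : Chain V (n+1) :=
  if h : Allowed G α ∧ ∃ γ : Path V (n+1), Allowed G γ ∧ IsFace α γ ∧ fPath f γ = fPath f α then
    (-(boundary V n (unitP h.2.choose) α)) • unitP h.2.choose
  else 0

/-- The discrete gradient vector field `V = grad f`, extended linearly to chains. -/
noncomputable def grad (G : Digraph V) (f : V → ℝ) (n : ℕ) : Chain V n →ₗ[ℝ] Chain V (n+1) where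
  toFun x := ∑ α : Path V n, x α • gradFun G f α
  map_add' x y := by simp [add_smul, Finset.sum_add_distrib]
  map_smul' c x := by simp [Finset.smul_sum, smul_smul]

/-- The composite `V∂` in degree `n` (zero in degree `0`). -/
noncomputable def vd (G : Digraph V) (f : V → ℝ) : (n : ℕ) → (Chain V n →ₗ[ℝ] Chain V n)
  | 0 => 0
  | (n+1) => (grad G f n).comp (boundary V n)

/-- The discrete gradient flow `Φ = Id + ∂V + V∂`. -/
noncomputable def flow (G : Digraph V) (f : V → ℝ) (n : ℕ) : Chain V n →ₗ[ℝ] Chain V n :=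
  LinearMap.id + (boundary V n).comp (grad G f n) + vd G f n

/-- `P_n^Φ(G) = {x ∈ P_n(G) : Φ x = x}`. -/
noncomputable def pPhi (G : Digraph V) (f : V → ℝ) (n : ℕ) : Submodule ℝ (Chain V n) :=
  pSpan G n ⊓ LinearMap.ker (flow G f n - LinearMap.id)

/-- The cycles of a chain complex of subspaces `C` with differentials `D`
(in degree `0`, everything is a cycle). -/
def cycles (C : ∀ n, Submodule ℝ (Chain V n)) (D : ∀ n, Chain V (n+1) →ₗ[ℝ] Chain V n) :
    (m : ℕ) → Submodule ℝ (Chain V m)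
  | 0 => C 0
  | (m+1) => C (m+1) ⊓ LinearMap.ker (D m)

/-- Homology of the chain complex `(C, D)`: cycles modulo boundaries coming from `C`. -/
abbrev Homology (C : ∀ n, Submodule ℝ (Chain V n)) (D : ∀ n, Chain V (n+1) →ₗ[ℝ] Chain V n)
    (m : ℕ) :=
  (cycles C D m) ⧸ (Submodule.comap (cycles C D m).subtype ((C (m+1)).map (D m)))

/-- The operator `e^{tf}` on chains. -/
noncomputable def expOp (f : V → ℝ) (t : ℝ) (n : ℕ) : Chain V n →ₗ[ℝ] Chain V n where
  toFun x := fun p => Real.exp (t * fPath f p) * x p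
  map_add' x y := by funext p; simp [mul_add]
  map_smul' c x := by funext p; simp; ring

/-- The deformed boundary `∂_t = e^{tf} ∂ e^{-tf}`. -/
noncomputable def dT (f : V → ℝ) (t : ℝ) (n : ℕ) : Chain V (n+1) →ₗ[ℝ] Chain V n :=
  (expOp f t n).comp ((boundary V n).comp (expOp f (-t) (n+1)))

/-- The span of the elementary `n`-paths that are critical in `Gbar` and allowed in `G`. -/
def critSpan (G Gbar : Digraph V) (f : V → ℝ) (n : ℕ) : Submodule ℝ (Chain V n) :=
  Submodule.span ℝ {x : Chain V n | ∃ α : Path V n, IsCritical Gbar f α ∧ Allowed G α ∧ x = unitP α}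

theorem Allowed.lt {V : Type} {G : Digraph V} (hG : G.Transitive) {n : ℕ} {p : Path V n}
    (hp : Allowed G p) {i j : Fin (n + 1)} (hij : i < j) : G.E (p i) (p j) := by
  have : IsTrans V G.E := ⟨fun u v w => hG u v w⟩
  exact (Fin.liftFun_iff_succ (f := p) G.E).2 hp hij

theorem Allowed.injective {V : Type} {G : Digraph V} (hG : G.Transitive) {n : ℕ} {p : Path V n}
    (hp : Allowed G p) : Function.Injective p := by
  intro i j hij
  rcases lt_trichotomy i j with h | h | h
  · exact absurd (hij ▸ hp.lt hG h) (G.irrefl _)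
  · exact h
  · exact absurd (hij ▸ hp.lt hG h) (G.irrefl _)

theorem Allowed.face {V : Type} {G : Digraph V} (hG : G.Transitive) {n : ℕ} {p : Path V (n + 1)}
    (hp : Allowed G p) (i : Fin (n + 2)) : Allowed G (face i p) := fun _ =>
  hp.lt hG (Fin.strictMono_succAbove i Fin.castSucc_lt_succ)

theorem Allowed.face_injective {V : Type} {G : Digraph V} (hG : G.Transitive) {n : ℕ}
    {p : Path V (n + 1)} (hp : Allowed G p) {i j : Fin (n + 2)}
    (h : PathMorse.face i p = PathMorse.face j p) : i = j :=
  Fin.succAbove_left_injective (funext fun k => hp.injective hG (congrFun h k))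

theorem fPath_face {V : Type} (f : V → ℝ) {n : ℕ} (i : Fin (n + 2)) (p : Path V (n + 1)) :
    fPath f p = f (p i) + fPath f (face i p) := by
  simp [fPath, face, Fin.sum_univ_succAbove _ i]

theorem fPath_eq_face_iff {V : Type} (f : V → ℝ) {n : ℕ} (i : Fin (n + 2)) (p : Path V (n + 1)) :
    fPath f p = fPath f (face i p) ↔ f (p i) = 0 := by
  rw [fPath_face f i p]; simp

/-- For a discrete Morse function on a transitive digraph, an allowed path of positive length
has at most one vertex where `f` vanishes. -/
theorem IsMorse.zero_unique {V : Type} {G : Digraph V} {f : V → ℝ} (hG : G.Transitive)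
    (hf : IsMorse G f) {n : ℕ} {p : Path V (n + 1)} (hp : Allowed G p) {i j : Fin (n + 2)}
    (hi : f (p i) = 0) (hj : f (p j) = 0) : i = j :=
  hp.face_injective hG (hf.2.2 n p hp _ _ (hp.face hG i) (hp.face hG j) ⟨i, rfl⟩ ⟨j, rfl⟩
    ((fPath_eq_face_iff f i p).2 hi).symm ((fPath_eq_face_iff f j p).2 hj).symm)

theorem IsMorse.not_hasEqualCoface {V : Type} {G : Digraph V} {f : V → ℝ} (hG : G.Transitive)
    (hf : IsMorse G f) {n : ℕ} {p : Path V n} {i : Fin (n + 1)} (hi : f (p i) = 0) :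
    ¬ HasEqualCoface G f p := by
  rintro ⟨γ, hγ, ⟨k, rfl⟩, hk⟩
  exact Fin.succAbove_ne k i
    (hf.zero_unique hG hγ (i := k.succAbove i) hi ((fPath_eq_face_iff f k γ).1 hk))

theorem boundary_unitP {V : Type} [Fintype V] [DecidableEq V] {n : ℕ} (p : Path V (n + 1)) :
    boundary V n (unitP p) = ∑ i : Fin (n + 2), (-1 : ℝ) ^ (i : ℕ) • unitP (face i p) := by
  funext q
  change boundaryFun (unitP p) q = _
  rw [boundaryFun, Finset.sum_eq_single p]
  · simp [unitP, Pi.single_apply, eq_comm]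
  · intro r _ hr
    simp [unitP, hr]
  · simp

theorem boundary_unitP_face {V : Type} [Fintype V] [DecidableEq V] {G : Digraph V}
    (hG : G.Transitive) {n : ℕ} {p : Path V (n + 1)} (hp : Allowed G p) (i : Fin (n + 2)) :
    boundary V n (unitP p) (face i p) = (-1 : ℝ) ^ (i : ℕ) := by
  rw [boundary_unitP, Finset.sum_apply, Finset.sum_eq_single i]
  · simp [unitP]
  · intro j _ hj
    have : face i p ≠ face j p := fun h => hj (hp.face_injective hG h).symm
    simp [unitP, this]
  · simp

theorem grad_unitP {V : Type} [Fintype V] [DecidableEq V] (G : Digraph V) (f : V → ℝ) {n : ℕ}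
    (p : Path V n) : grad G f n (unitP p) = gradFun G f p := by
  change ∑ α, unitP p α • gradFun G f α = _
  rw [Finset.sum_eq_single p]
  · simp [unitP]
  · intro q _ hq
    simp [unitP, hq]
  · simp

theorem chain_eq_sum {V : Type} [Fintype V] [DecidableEq V] {n : ℕ} (x : Chain V n) :
    x = ∑ p, x p • unitP p := by
  funext q
  simp [unitP, Pi.single_apply]

theorem gradFun_eq_zero {V : Type} [Fintype V] [DecidableEq V] {G : Digraph V} {f : V → ℝ} {n : ℕ}
    {p : Path V n} (h : ¬ (Allowed G p ∧ HasEqualCoface G f p)) : gradFun G f p = 0 :=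
  dif_neg h

theorem gradFun_face {V : Type} [Fintype V] [DecidableEq V] {G : Digraph V} {f : V → ℝ}
    (hG : G.Transitive) (hf : IsMorse G f) {n : ℕ} {γ : Path V (n + 1)} (hγ : Allowed G γ)
    {i : Fin (n + 2)} (hi : f (γ i) = 0) :
    gradFun G f (face i γ) = (-(-1 : ℝ) ^ (i : ℕ)) • unitP γ := by
  have hv := (fPath_eq_face_iff f i γ).2 hi
  have h : Allowed G (face i γ) ∧ ∃ δ : Path V (n + 1), Allowed G δ ∧ IsFace (face i γ) δ ∧
      fPath f δ = fPath f (face i γ) := ⟨hγ.face hG i, γ, hγ, ⟨i, rfl⟩, hv⟩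
  have hc : h.2.choose = γ := hf.2.1 n _ h.1 _ _ h.2.choose_spec.1 hγ h.2.choose_spec.2.1 ⟨i, rfl⟩
    h.2.choose_spec.2.2 hv
  rw [gradFun, dif_pos h, hc, boundary_unitP_face hG hγ]

theorem gradFun_cases {V : Type} [Fintype V] [DecidableEq V] {G : Digraph V} {f : V → ℝ}
    (hG : G.Transitive) (hf : IsMorse G f) {n : ℕ} (p : Path V n) :
    gradFun G f p = 0 ∨ ∃ (γ : Path V (n + 1)) (i : Fin (n + 2)), Allowed G γ ∧ f (γ i) = 0 ∧
      face i γ = p ∧ gradFun G f p = (-(-1 : ℝ) ^ (i : ℕ)) • unitP γ := by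
  by_cases h : Allowed G p ∧ HasEqualCoface G f p
  · obtain ⟨-, γ, hγ, ⟨i, rfl⟩, hv⟩ := h
    have hi := (fPath_eq_face_iff f i γ).1 hv
    exact Or.inr ⟨γ, i, hγ, hi, rfl, gradFun_face hG hf hγ hi⟩
  · exact Or.inl (gradFun_eq_zero h)

theorem grad_mem_pSpan {V : Type} [Fintype V] [DecidableEq V] {G : Digraph V} {f : V → ℝ}
    (hG : G.Transitive) (hf : IsMorse G f) {n : ℕ} (x : Chain V n) :
    grad G f n x ∈ pSpan G (n + 1) := by
  refine Submodule.sum_mem _ fun p _ => Submodule.smul_mem _ _ ?_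
  obtain h | ⟨γ, i, hγ, -, -, h⟩ := gradFun_cases hG hf p
  · rw [h]; exact Submodule.zero_mem _
  · rw [h]; exact Submodule.smul_mem _ _ (Submodule.subset_span ⟨γ, hγ, rfl⟩)

theorem grad_grad {V : Type} [Fintype V] [DecidableEq V] {G : Digraph V} {f : V → ℝ}
    (hG : G.Transitive) (hf : IsMorse G f) {n : ℕ} (x : Chain V n) :
    grad G f (n + 1) (grad G f n x) = 0 := by
  rw [chain_eq_sum x]
  simp only [map_sum, map_smul, grad_unitP]
  refine Finset.sum_eq_zero fun p _ => ?_
  obtain h | ⟨γ, i, -, hi, -, h⟩ := gradFun_cases hG hf p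
  · simp [h]
  · rw [h, map_smul, grad_unitP,
      gradFun_eq_zero fun hc => hf.not_hasEqualCoface hG hi hc.2, smul_zero, smul_zero]

/-- `V∂γ = -γ` for an allowed path `γ` of positive length with a vertex where `f` vanishes. -/
theorem grad_boundary_unitP {V : Type} [Fintype V] [DecidableEq V] {G : Digraph V} {f : V → ℝ}
    (hG : G.Transitive) (hf : IsMorse G f) {n : ℕ} {γ : Path V (n + 1)} (hγ : Allowed G γ)
    {i : Fin (n + 2)} (hi : f (γ i) = 0) :
    grad G f n (boundary V n (unitP γ)) = -unitP γ := by
  rw [boundary_unitP]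
  simp only [map_sum, map_smul, grad_unitP]
  rw [Finset.sum_eq_single i]
  · rw [gradFun_face hG hf hγ hi, smul_smul, mul_neg, ← mul_pow]
    simp
  · intro j _ hj
    obtain ⟨k, hk⟩ := Fin.exists_succAbove_eq hj.symm
    rw [gradFun_eq_zero fun hc => hf.not_hasEqualCoface hG (i := k) ?_ hc.2, smul_zero]
    simpa [face, hk] using hi
  · simp

theorem grad_boundary_grad {V : Type} [Fintype V] [DecidableEq V] {G : Digraph V} {f : V → ℝ}
    (hG : G.Transitive) (hf : IsMorse G f) {n : ℕ} (x : Chain V n) :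
    grad G f n (boundary V n (grad G f n x)) = -grad G f n x := by
  rw [chain_eq_sum x]
  simp only [map_sum, map_smul, grad_unitP, ← Finset.sum_neg_distrib]
  refine Finset.sum_congr rfl fun p _ => ?_
  obtain h | ⟨γ, i, hγ, hi, -, h⟩ := gradFun_cases hG hf p
  · simp [h]
  · simp only [h, map_smul, grad_boundary_unitP hG hf hγ hi, smul_neg]

theorem grad_vd {V : Type} [Fintype V] [DecidableEq V] {G : Digraph V} {f : V → ℝ}
    (hG : G.Transitive) (hf : IsMorse G f) : ∀ {n : ℕ} (x : Chain V n),
    grad G f n (vd G f n x) = 0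
  | 0, _ => map_zero _
  | _ + 1, _ => grad_grad hG hf _

theorem vd_vd {V : Type} [Fintype V] [DecidableEq V] {G : Digraph V} {f : V → ℝ}
    (hG : G.Transitive) (hf : IsMorse G f) : ∀ {n : ℕ} (x : Chain V n),
    vd G f n (vd G f n x) = -vd G f n x
  | 0, _ => by simp [vd]
  | _ + 1, _ => grad_boundary_grad hG hf _

theorem vd_mem_pSpan {V : Type} [Fintype V] [DecidableEq V] {G : Digraph V} {f : V → ℝ}
    (hG : G.Transitive) (hf : IsMorse G f) : ∀ {n : ℕ} (x : Chain V n),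
    vd G f n x ∈ pSpan G n
  | 0, _ => Submodule.zero_mem _
  | _ + 1, _ => grad_mem_pSpan hG hf _

theorem unitP_add_vd_eq_zero {V : Type} [Fintype V] [DecidableEq V] {G : Digraph V} {f : V → ℝ}
    (hG : G.Transitive) (hf : IsMorse G f) : ∀ {n : ℕ} {p : Path V n}, Allowed G p →
    HasEqualFace G f n p → unitP p + vd G f n (unitP p) = 0
  | 0, _, _, h => h.elim
  | _ + 1, p, hp, ⟨_, _, ⟨i, rfl⟩, hv⟩ => by
    change unitP p + grad G f _ (boundary V _ (unitP p)) = 0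
    rw [grad_boundary_unitP hG hf hp ((fPath_eq_face_iff f i p).1 hv.symm), add_neg_cancel]

theorem apply_eq_zero_of_mem_pSpan {V : Type} [Fintype V] [DecidableEq V] {G : Digraph V} {n : ℕ}
    {x : Chain V n} (hx : x ∈ pSpan G n) {p : Path V n} (hp : ¬ Allowed G p) : x p = 0 := by
  induction hx using Submodule.span_induction with
  | mem y hy =>
    obtain ⟨q, hq, rfl⟩ := hy
    have : p ≠ q := fun h => hp (h ▸ hq)
    simp [unitP, this]
  | zero => rfl
  | add y z _ _ hy hz => simp [hy, hz]
  | smul c y _ hy => simp [hy]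

theorem apply_eq_zero_of_grad_eq_zero {V : Type} [Fintype V] [DecidableEq V] {G : Digraph V}
    {f : V → ℝ} (hG : G.Transitive) (hf : IsMorse G f) {n : ℕ} {x : Chain V n}
    (hx : grad G f n x = 0) {p : Path V n} (hp : HasEqualCoface G f p) : x p = 0 := by
  obtain ⟨γ, hγ, ⟨i, rfl⟩, hv⟩ := hp
  have hi := (fPath_eq_face_iff f i γ).1 hv
  have h : (∑ α, x α • gradFun G f α) γ = 0 := congrFun hx γ
  rw [Finset.sum_apply, Finset.sum_eq_single (face i γ)] at h
  · simpa [gradFun_face hG hf hγ hi, unitP] using h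
  · intro α _ hα
    obtain h0 | ⟨δ, j, -, hj, rfl, h0⟩ := gradFun_cases hG hf α
    · simp [h0]
    · have : γ ≠ δ := by
        rintro rfl
        exact hα (by rw [hf.zero_unique hG hγ hi hj])
      simp [h0, unitP, this]
  · simp

theorem mem_pPhi_iff {V : Type} [Fintype V] [DecidableEq V] {G : Digraph V} {f : V → ℝ}
    (hG : G.Transitive) (hf : IsMorse G f) {n : ℕ} {x : Chain V n} :
    x ∈ pPhi G f n ↔ x ∈ pSpan G n ∧ grad G f n x = 0 ∧ vd G f n x = 0 := by
  have hflow : (flow G f n - LinearMap.id : Chain V n →ₗ[ℝ] Chain V n) x =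
      boundary V n (grad G f n x) + vd G f n x := by
    simp [flow, add_assoc]
  rw [pPhi, Submodule.mem_inf, LinearMap.mem_ker, hflow]
  refine and_congr_right fun _ => ⟨fun h => ?_, fun ⟨h₁, h₂⟩ => by simp [h₁, h₂]⟩
  have hg : grad G f n x = 0 := by
    have := congrArg (grad G f n) h
    rwa [map_add, grad_boundary_grad hG hf, grad_vd hG hf, add_zero, map_zero, neg_eq_zero] at this
  exact ⟨hg, by simpa [hg] using h⟩

/-- On a transitive digraph, the `Φ`-invariant chains are exactly the span of the
chains `α + V∂α` over critical paths `α`. -/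
theorem stmt11 {V : Type} [Fintype V] [DecidableEq V] (G : Digraph V) (f : V → ℝ)
    (hG : G.Transitive) (hf : IsMorse G f) (n : ℕ) :
    pPhi G f n = Submodule.span ℝ
      {x : Chain V n | ∃ α : Path V n, IsCritical G f α ∧ x = unitP α + vd G f n (unitP α)} := by
  apply le_antisymm
  · intro x hx
    obtain ⟨hP, hg, hv⟩ := (mem_pPhi_iff hG hf).1 hx
    have hsum : x = ∑ p, x p • (unitP p + vd G f n (unitP p)) := by
      conv_lhs => rw [← add_zero x, ← hv, chain_eq_sum x]
      simp only [map_sum, map_smul, smul_add, Finset.sum_add_distrib]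
    rw [hsum]
    refine Submodule.sum_mem _ fun p _ => ?_
    by_cases hp : Allowed G p
    · by_cases hc : HasEqualCoface G f p
      · simp [apply_eq_zero_of_grad_eq_zero hG hf hg hc]
      · by_cases hF : HasEqualFace G f n p
        · simp [unitP_add_vd_eq_zero hG hf hp hF]
        · exact Submodule.smul_mem _ _ (Submodule.subset_span ⟨p, ⟨hp, hc, hF⟩, rfl⟩)
    · simp [apply_eq_zero_of_mem_pSpan hP hp]
  · rw [Submodule.span_le]
    rintro _ ⟨α, ⟨hα, hc, -⟩, rfl⟩
    refine (mem_pPhi_iff hG hf).2 ⟨Submodule.add_mem _ (Submodule.subset_span ⟨α, hα, rfl⟩)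
      (vd_mem_pSpan hG hf _), ?_, ?_⟩
    · rw [map_add, grad_vd hG hf, grad_unitP, gradFun_eq_zero fun h => hc h.2, add_zero]
    · rw [map_add, vd_vd hG hf, add_neg_cancel]

end PathMorse
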